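/- Let X be a measurable space, ρ a finite measure on X, and 0 < c₁ ≤ c₂. Let λ*, λ : X → ℝ be measurable with c₁ ≤ λ*(x) ≤ c₂ and c₁ ≤ λ(x) ≤ c₂ for all x ∈ X. Define the expected log-likelihood functional L[λ] = ∫_X ( λ*(x) · log λ(x) − λ(x) ) dρ(x). Then L[λ*] − L[λ] ≥ (c₁/(2 c₂²)) ∫_X (λ(x) − λ*(x))² dρ(x) ≥ 0. In particular, λ* is a global maximizer of L over all measurable functions with values in [c₁, c₂]. -/

import Mathlib

open MeasureTheory

lemma aux_deriv (a c y : ℝ) (hy : 0 < y) :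
    HasDerivAt (fun b : ℝ => -Real.log b + (b - a) / a - (b - a) ^ 2 / (2 * c ^ 2))
      (-y⁻¹ + 1 / a - (2 * (y - a)) / (2 * c ^ 2)) y := by
  have h1 := (Real.hasDerivAt_log hy.ne').neg
  have h2 := ((hasDerivAt_id y).sub_const a).div_const a
  have h3 := (((hasDerivAt_id y).sub_const a).pow 2).div_const (2 * c ^ 2)
  have h4 := (h1.add h2).sub h3
  refine HasDerivAt.congr_deriv (f' := _) h4 ?_
  simp

lemma aux_factor (a c y : ℝ) (ha : 0 < a) (hc : 0 < c) (hy : 0 < y) :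
    -y⁻¹ + 1 / a - (2 * (y - a)) / (2 * c ^ 2) = (y - a) * (1 / (a * y) - 1 / c ^ 2) := by
  field_simp
  ring

lemma aux_coef (a c y : ℝ) (ha : 0 < a) (hac : a ≤ c) (hy : 0 < y) (hyc : y ≤ c) :
    0 ≤ 1 / (a * y) - 1 / c ^ 2 := by
  have : a * y ≤ c ^ 2 := by nlinarith
  have := one_div_le_one_div_of_le (mul_pos ha hy) this
  linarith

lemma aux_log (a b c : ℝ) (ha : 0 < a) (hac : a ≤ c) (hb : 0 < b) (hbc : b ≤ c) :
    (b - a) ^ 2 / (2 * c ^ 2) ≤ Real.log a - Real.log b + (b - a) / a := by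
  have hc : 0 < c := ha.trans_le hac
  set g := fun b : ℝ => -Real.log b + (b - a) / a - (b - a) ^ 2 / (2 * c ^ 2) with hg
  have ga : g a = -Real.log a := by simp [hg]
  have key : g a ≤ g b := by
    rcases lt_trichotomy a b with h | h | h
    · obtain ⟨y, hy, e⟩ := exists_hasDerivAt_eq_slope g _ h
        (fun y hy => (aux_deriv a c y (ha.trans_le hy.1)).continuousAt.continuousWithinAt)
        (fun y hy => aux_deriv a c y (ha.trans hy.1))
      have y0 : 0 < y := ha.trans hy.1
      rw [aux_factor a c y ha hc y0, eq_div_iff (by linarith)] at e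
      have := aux_coef a c y ha hac y0 (hy.2.le.trans hbc)
      have := mul_nonneg (mul_nonneg (sub_nonneg.2 hy.1.le) this) (sub_nonneg.2 h.le)
      linarith
    · rw [h]
    · obtain ⟨y, hy, e⟩ := exists_hasDerivAt_eq_slope g _ h
        (fun y hy => (aux_deriv a c y (hb.trans_le hy.1)).continuousAt.continuousWithinAt)
        (fun y hy => aux_deriv a c y (hb.trans hy.1))
      have y0 : 0 < y := hb.trans hy.1
      rw [aux_factor a c y ha hc y0, eq_div_iff (by linarith)] at e
      have := aux_coef a c y ha hac y0 (hy.2.le.trans hac)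
      have := mul_nonneg (mul_nonneg (sub_nonneg.2 hy.2.le) this) (sub_nonneg.2 h.le)
      linarith
  rw [ga] at key
  simp only [hg] at key
  linarith

lemma aux_point (a b c₁ c₂ : ℝ) (h1 : 0 < c₁) (ha : c₁ ≤ a ∧ a ≤ c₂) (hb : c₁ ≤ b ∧ b ≤ c₂) :
    c₁ / (2 * c₂ ^ 2) * (b - a) ^ 2 ≤ (a * Real.log a - a) - (a * Real.log b - b) := by
  have a0 : 0 < a := h1.trans_le ha.1
  have h := mul_le_mul_of_nonneg_left
    (aux_log a b c₂ a0 ha.2 (h1.trans_le hb.1) hb.2) a0.le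
  have h2 : c₁ * ((b - a) ^ 2 / (2 * c₂ ^ 2)) ≤ a * ((b - a) ^ 2 / (2 * c₂ ^ 2)) :=
    mul_le_mul_of_nonneg_right ha.1 (by positivity)
  have h3 : a * (Real.log a - Real.log b + (b - a) / a)
      = (a * Real.log a - a) - (a * Real.log b - b) := by
    field_simp
    ring
  have h4 : c₁ / (2 * c₂ ^ 2) * (b - a) ^ 2 = c₁ * ((b - a) ^ 2 / (2 * c₂ ^ 2)) := by ring
  linarith

lemma aux_int {X : Type*} [MeasurableSpace X] (ρ : Measure X) [IsFiniteMeasure ρ]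
    (c₁ c₂ : ℝ) (hc₁ : 0 < c₁) (f g : X → ℝ) (hf : Measurable f) (hg : Measurable g)
    (hbf : ∀ x, c₁ ≤ f x ∧ f x ≤ c₂) (hbg : ∀ x, c₁ ≤ g x ∧ g x ≤ c₂) :
    Integrable (fun x => f x * Real.log (g x) - g x) ρ := by
  refine Integrable.of_bound (by fun_prop)
    (c₂ * (|Real.log c₁| + |Real.log c₂|) + c₂) (Filter.Eventually.of_forall fun x => ?_)
  obtain ⟨f1, f2⟩ := hbf x
  obtain ⟨g1, g2⟩ := hbg x
  have l1 := Real.log_le_log hc₁ g1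
  have l2 := Real.log_le_log (hc₁.trans_le g1) g2
  have hl : |Real.log (g x)| ≤ |Real.log c₁| + |Real.log c₂| := by
    rw [abs_le]
    constructor
    · linarith [neg_abs_le (Real.log c₁), abs_nonneg (Real.log c₂)]
    · linarith [le_abs_self (Real.log c₂), abs_nonneg (Real.log c₁)]
  have f0 : 0 ≤ f x := by linarith
  rw [Real.norm_eq_abs]
  refine (abs_sub _ _).trans ?_
  rw [abs_mul, abs_of_nonneg f0, abs_of_nonneg (by linarith : 0 ≤ g x)]
  gcongr
  linarith

/-- Deterministic, intensity-level content of kernel identifiability (Theorem 1):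
for the expected log-likelihood `L[λ] = ∫ (λ* log λ − λ) dρ` and intensities with
values in `[c₁, c₂]`, `0 < c₁ ≤ c₂`,
`L[λ*] − L[λ] ≥ (c₁/(2c₂²)) ∫ (λ − λ*)² dρ ≥ 0`; in particular `λ*` is a global
maximizer of `L`. -/
theorem expected_loglik_gap
    {X : Type*} [MeasurableSpace X]
    (ρ : Measure X) [IsFiniteMeasure ρ]
    (c₁ c₂ : ℝ) (hc₁ : 0 < c₁) (hc : c₁ ≤ c₂)
    (lamStar lam : X → ℝ)
    (hmStar : Measurable lamStar) (hm : Measurable lam)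
    (hbStar : ∀ x, c₁ ≤ lamStar x ∧ lamStar x ≤ c₂)
    (hb : ∀ x, c₁ ≤ lam x ∧ lam x ≤ c₂) :
    ((∫ x, (lamStar x * Real.log (lamStar x) - lamStar x) ∂ρ)
        - ∫ x, (lamStar x * Real.log (lam x) - lam x) ∂ρ
      ≥ (c₁ / (2 * c₂ ^ 2)) * ∫ x, (lam x - lamStar x) ^ 2 ∂ρ)
    ∧ (c₁ / (2 * c₂ ^ 2)) * (∫ x, (lam x - lamStar x) ^ 2 ∂ρ) ≥ 0
    ∧ (∫ x, (lamStar x * Real.log (lam x) - lam x) ∂ρ)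
        ≤ ∫ x, (lamStar x * Real.log (lamStar x) - lamStar x) ∂ρ := by
  have i1 := aux_int ρ c₁ c₂ hc₁ lamStar lamStar hmStar hmStar hbStar hbStar
  have i2 := aux_int ρ c₁ c₂ hc₁ lamStar lam hmStar hm hbStar hb
  have i3 : Integrable (fun x => (lam x - lamStar x) ^ 2) ρ := by
    refine Integrable.of_bound (by fun_prop) (c₂ ^ 2) (Filter.Eventually.of_forall fun x => ?_)
    obtain ⟨f1, f2⟩ := hbStar x
    obtain ⟨g1, g2⟩ := hb x
    rw [Real.norm_eq_abs, abs_of_nonneg (sq_nonneg _)]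
    exact sq_le_sq' (by linarith) (by linarith)
  have A : c₁ / (2 * c₂ ^ 2) * (∫ x, (lam x - lamStar x) ^ 2 ∂ρ)
      ≤ (∫ x, (lamStar x * Real.log (lamStar x) - lamStar x) ∂ρ)
        - ∫ x, (lamStar x * Real.log (lam x) - lam x) ∂ρ := by
    rw [← integral_const_mul, ← integral_sub i1 i2]
    exact integral_mono (i3.const_mul _) (i1.sub i2)
      (fun x => aux_point _ _ _ _ hc₁ (hbStar x) (hb x))
  have B : 0 ≤ c₁ / (2 * c₂ ^ 2) * (∫ x, (lam x - lamStar x) ^ 2 ∂ρ) :=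
    mul_nonneg (by positivity) (integral_nonneg fun x => sq_nonneg _)
  exact ⟨A, B, by linarith⟩
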